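/- Let B be a positive square-free integer and C a square-free integer with C ∉ {0, 1, 2, 2B} such that L = ℚ(√B, √(2B), √C) is a triquadratic number field (so 2B is also square-free, i.e. B is odd). Then min deg_L(√B + √(2B)) = 2 if and only if B is a congruent number. -/

import Mathlib

/-- The minimal degree of an algebraic number `v ∈ L`: the minimum, over all primitive
elements `α` of `L` (i.e. `ℚ(α) = L`), of the degree of a polynomial `f ∈ ℚ[x]`
with `f(α) = v`. -/
noncomputable def minDegree (L : Type*) [Field L] [Algebra ℚ L] (v : L) : ℕ :=
  sInf {d : ℕ | ∃ α : L, IntermediateField.adjoin ℚ {α} = ⊤ ∧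
    ∃ f : Polynomial ℚ, f.natDegree = d ∧ Polynomial.aeval α f = v}

/-- `n` is a congruent number: it is the area of a right triangle with rational sides. -/
def IsCongruentNumber (n : ℤ) : Prop :=
  ∃ x y z : ℚ, 0 < x ∧ 0 < y ∧ 0 < z ∧ x ^ 2 + y ^ 2 = z ^ 2 ∧ x * y / 2 = (n : ℚ)

/-- The subalgebra `S + S t` where `t ^ 2 ∈ S`. -/
def quadExt {L : Type*} [Field L] [Algebra ℚ L] (S : Subalgebra ℚ L) (t : L) (ht : t ^ 2 ∈ S) :
    Subalgebra ℚ L where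
  carrier := {x | ∃ X ∈ S, ∃ Y ∈ S, x = X + Y * t}
  mul_mem' := by
    rintro _ _ ⟨X, hX, Y, hY, rfl⟩ ⟨X', hX', Y', hY', rfl⟩
    refine ⟨X * X' + Y * Y' * t ^ 2, ?_, X * Y' + X' * Y, ?_, by ring⟩
    · exact S.add_mem (S.mul_mem hX hX') (S.mul_mem (S.mul_mem hY hY') ht)
    · exact S.add_mem (S.mul_mem hX hY') (S.mul_mem hX' hY)
  add_mem' := by
    rintro _ _ ⟨X, hX, Y, hY, rfl⟩ ⟨X', hX', Y', hY', rfl⟩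
    exact ⟨X + X', S.add_mem hX hX', Y + Y', S.add_mem hY hY', by ring⟩
  algebraMap_mem' := fun r => ⟨algebraMap ℚ L r, S.algebraMap_mem r, 0, S.zero_mem, by ring⟩

theorem mem_quadExt {L : Type*} [Field L] [Algebra ℚ L] (S : Subalgebra ℚ L) (t : L)
    (ht : t ^ 2 ∈ S) (x : L) : x ∈ quadExt S t ht ↔ ∃ X ∈ S, ∃ Y ∈ S, x = X + Y * t := Iff.rfl

theorem le_quadExt {L : Type*} [Field L] [Algebra ℚ L] (S : Subalgebra ℚ L) (t : L)
    (ht : t ^ 2 ∈ S) : S ≤ quadExt S t ht := fun x hx => ⟨x, hx, 0, S.zero_mem, by ring⟩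

theorem self_mem_quadExt {L : Type*} [Field L] [Algebra ℚ L] (S : Subalgebra ℚ L) (t : L)
    (ht : t ^ 2 ∈ S) : t ∈ quadExt S t ht := ⟨0, S.zero_mem, 1, S.one_mem, by ring⟩

theorem subalg_eq_top {L : Type*} [Field L] [Algebra ℚ L] [FiniteDimensional ℚ L]
    (S : Subalgebra ℚ L) (s : Set L) (hs : s ⊆ S) (h : IntermediateField.adjoin ℚ s = ⊤) :
    S = ⊤ := by
  have hS : S.IsAlgebraic := fun x _ => Algebra.IsAlgebraic.isAlgebraic x
  have hle : IntermediateField.adjoin ℚ s ≤ hS.toIntermediateField :=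
    IntermediateField.adjoin_le_iff.2 hs
  rw [h] at hle
  rw [eq_top_iff]
  intro x _
  exact hle (IntermediateField.mem_top : x ∈ (⊤ : IntermediateField ℚ L))

/-- The subfield structure of `ℚ(√2, √B)` inside `L`. -/
theorem structure_lemma {L : Type*} [Field L] [Algebra ℚ L] [FiniteDimensional ℚ L]
    (B C : ℚ) (e u w : L) (he : e ^ 2 = 2)
    (hu : u ^ 2 = algebraMap ℚ L B) (hw : w ^ 2 = algebraMap ℚ L C)
    (hgen : IntermediateField.adjoin ℚ {u, e * u, w} = ⊤)
    (hdim : Module.finrank ℚ L = 8) :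
    ∃ K : Subalgebra ℚ L, e ∈ K ∧ u ∈ K ∧
      (∀ x ∈ K, ∃ a b c d : ℚ, x = algebraMap ℚ L a + algebraMap ℚ L b * e
        + (algebraMap ℚ L c + algebraMap ℚ L d * e) * u) ∧
      (∀ x : L, ∃ X ∈ K, ∃ Y ∈ K, x = X + Y * w) ∧
      (∀ X ∈ K, ∀ Y ∈ K, X + Y * w = 0 → X = 0 ∧ Y = 0) ∧
      (∀ a b c d : ℚ, algebraMap ℚ L a + algebraMap ℚ L b * e
        + (algebraMap ℚ L c + algebraMap ℚ L d * e) * u = 0 → a = 0 ∧ b = 0 ∧ c = 0 ∧ d = 0) := by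
  have he' : e ^ 2 ∈ (⊥ : Subalgebra ℚ L) := by
    rw [he]; exact_mod_cast (⊥ : Subalgebra ℚ L).natCast_mem 2
  set S1 := quadExt ⊥ e he' with hS1
  have hu' : u ^ 2 ∈ S1 := by rw [hu]; exact S1.algebraMap_mem _
  set K := quadExt S1 u hu' with hK
  have hw' : w ^ 2 ∈ K := by rw [hw]; exact K.algebraMap_mem _
  have heK : e ∈ K := le_quadExt _ _ _ (self_mem_quadExt _ _ _)
  have huK : u ∈ K := self_mem_quadExt _ _ _
  have hform : ∀ x ∈ K, ∃ a b c d : ℚ, x = algebraMap ℚ L a + algebraMap ℚ L b * e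
        + (algebraMap ℚ L c + algebraMap ℚ L d * e) * u := by
    rintro _ ⟨_, ⟨X, hX, Y, hY, rfl⟩, _, ⟨X', hX', Y', hY', rfl⟩, rfl⟩
    obtain ⟨a, rfl⟩ := Algebra.mem_bot.1 hX
    obtain ⟨b, rfl⟩ := Algebra.mem_bot.1 hY
    obtain ⟨c, rfl⟩ := Algebra.mem_bot.1 hX'
    obtain ⟨d, rfl⟩ := Algebra.mem_bot.1 hY'
    exact ⟨a, b, c, d, rfl⟩
  have htop : quadExt K w hw' = ⊤ := by
    apply subalg_eq_top _ {u, e * u, w} _ hgen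
    rintro x (rfl | rfl | rfl)
    · exact le_quadExt _ _ _ huK
    · exact le_quadExt _ _ _ (K.mul_mem heK huK)
    · exact self_mem_quadExt _ _ _
  have hall : ∀ x : L, ∃ X ∈ K, ∃ Y ∈ K, x = X + Y * w := by
    intro x
    have : x ∈ quadExt K w hw' := by rw [htop]; trivial
    exact this
  have hli : LinearIndependent ℚ ![1, e, u, e * u, w, e * w, u * w, e * u * w] := by
    apply linearIndependent_of_top_le_span_of_card_eq_finrank _ (by simp [hdim])
    intro x _
    obtain ⟨X, hX, Y, hY, rfl⟩ := hall x
    obtain ⟨a, b, c, d, rfl⟩ := hform X hX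
    obtain ⟨a', b', c', d', rfl⟩ := hform Y hY
    rw [Submodule.mem_span_range_iff_exists_fun]
    refine ⟨![a, b, c, d, a', b', c', d'], ?_⟩
    simp [Fin.sum_univ_eight, Algebra.smul_def]
    ring
  have key : ∀ a b c d a' b' c' d' : ℚ, (algebraMap ℚ L a + algebraMap ℚ L b * e
        + (algebraMap ℚ L c + algebraMap ℚ L d * e) * u) + (algebraMap ℚ L a' + algebraMap ℚ L b' * e
        + (algebraMap ℚ L c' + algebraMap ℚ L d' * e) * u) * w = 0 →
        (a = 0 ∧ b = 0 ∧ c = 0 ∧ d = 0) ∧ (a' = 0 ∧ b' = 0 ∧ c' = 0 ∧ d' = 0) := by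
    intro a b c d a' b' c' d' h
    have := Fintype.linearIndependent_iff.1 hli ![a, b, c, d, a', b', c', d'] (by
      simp [Fin.sum_univ_eight, Algebra.smul_def]
      simp at h
      rw [← h]
      ring)
    exact ⟨⟨this 0, this 1, this 2, this 3⟩, ⟨this 4, this 5, this 6, this 7⟩⟩
  refine ⟨K, heK, huK, hform, hall, ?_, ?_⟩
  · intro X hX Y hY h
    obtain ⟨a, b, c, d, rfl⟩ := hform X hX
    obtain ⟨a', b', c', d', rfl⟩ := hform Y hY
    obtain ⟨⟨rfl, rfl, rfl, rfl⟩, rfl, rfl, rfl, rfl⟩ := key _ _ _ _ _ _ _ _ h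
    simp
  · intro a b c d h
    exact (key a b c d 0 0 0 0 (by rw [h]; simp)).1

/-- Arithmetic: from a congruent number to a point. -/
theorem congr_forward (B : ℤ) (h : IsCongruentNumber B) :
    ∃ p q r t : ℚ, p * q + B * (r * t) = 0 ∧ p * r + 2 * (q * t) = p * t + q * r ∧
      p * t + q * r ≠ 0 := by
  obtain ⟨x, y, z, hx, hy, hz, h1, h2⟩ := h
  set b : ℚ := (B : ℚ) with hb
  have hbpos : 0 < b := by rw [← h2]; positivity
  obtain ⟨m, hm⟩ : ∃ m, m = (x + z) / y := ⟨_, rfl⟩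
  have hzy : y < z := by nlinarith
  have hm1 : 1 < m := by rw [hm, lt_div_iff₀ hy]; linarith
  obtain ⟨Y, hY⟩ : ∃ Y, Y = 2 * m / y := ⟨_, rfl⟩
  have hYpos : 0 < Y := by rw [hY]; positivity
  have hmy : m * y = x + z := by rw [hm]; field_simp
  have hYy : Y * y = 2 * m := by rw [hY]; field_simp
  have e1 : 2 * x * m = (m ^ 2 - 1) * y := by
    have : (2 * x * m) * y = ((m ^ 2 - 1) * y) * y := by
      have : ((m ^ 2 - 1) * y) * y = (m * y) ^ 2 - y ^ 2 := by ring
      rw [this, hmy, mul_assoc, hmy]; linarith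
    exact mul_right_cancel₀ hy.ne' this
  have hcurve : b * Y ^ 2 = m ^ 3 - m := by
    have : (b * Y ^ 2) * y = (m ^ 3 - m) * y := by
      have : (b * Y ^ 2) * y ^ 2 = ((m ^ 3 - m) * y) * y := by
        have : (b * Y ^ 2) * y ^ 2 = b * (Y * y) ^ 2 := by ring
        rw [this, hYy, ← h2]
        linear_combination (m * y) * e1
      apply mul_right_cancel₀ hy.ne'
      linear_combination this
    exact mul_right_cancel₀ hy.ne' this
  refine ⟨(1 - m) * b * Y, b * Y, (m + 1) * (m - 1), m * (m - 1), ?_, ?_, ?_⟩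
  · linear_combination b * (1 - m) * hcurve
  · ring
  · have : (1 - m) * b * Y * (m * (m - 1)) + b * Y * ((m + 1) * (m - 1))
        = b * Y * (m - 1) * (2 - (m - 1) ^ 2) := by ring
    rw [this]
    have hs : (2 : ℚ) - (m - 1) ^ 2 ≠ 0 := by
      intro h
      apply irrational_sqrt_two.ne_rat (m - 1)
      have : ((m - 1 : ℚ) : ℝ) ^ 2 = 2 := by
        have : (m - 1) ^ 2 = 2 := by linarith
        exact_mod_cast this
      rw [← this, Real.sqrt_sq]
      have : 0 ≤ m - 1 := by linarith
      exact_mod_cast this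
    have : m - 1 ≠ 0 := by linarith
    positivity

/-- Arithmetic: from a point to a congruent number. -/
theorem congr_backward (B : ℤ) (hB : 0 < B) (p q r t : ℚ) (h1 : p * q + B * (r * t) = 0)
    (h2 : p * r + 2 * (q * t) = p * t + q * r) (h3 : p * t + q * r ≠ 0) :
    IsCongruentNumber B := by
  have hb : (0 : ℚ) < B := by exact_mod_cast hB
  unfold IsCongruentNumber
  generalize (B : ℚ) = b at *
  have hq : q ≠ 0 := by
    rintro rfl
    have : r * t = 0 := by simpa [hb.ne'] using h1
    grind
  have ht : t ≠ 0 := by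
    rintro rfl
    grind
  obtain ⟨x, hx⟩ : ∃ x, x = 1 - p / q := ⟨_, rfl⟩
  obtain ⟨R, hR⟩ : ∃ R, R = r / t := ⟨_, rfl⟩
  obtain ⟨g, hg⟩ : ∃ g, g = q / t := ⟨_, rfl⟩
  have hp' : p = (1 - x) * q := by rw [hx]; field_simp; ring
  have hr' : r = R * t := by rw [hR]; field_simp
  have hq' : q = g * t := by rw [hg]; field_simp
  have hg0 : g ≠ 0 := by rintro rfl; simp at hq'; exact hq hq'
  have k1 : (1 - x) * g ^ 2 + b * R = 0 := by
    have : t ^ 2 * ((1 - x) * g ^ 2 + b * R) = 0 := by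
      rw [← h1, hp', hr', hq']; ring
    simpa [ht] using this
  have k2 : x * R = 1 + x := by
    have : (g * t ^ 2) * (x * R - (1 + x)) = 0 := by
      rw [hp', hr', hq'] at h2
      linear_combination -h2
    have := (mul_eq_zero.1 this).resolve_left (by positivity)
    linarith
  have hx0 : x ≠ 0 := by rintro rfl; norm_num at k2
  have hxm : x ^ 2 - 1 ≠ 0 := by
    intro h
    have : (x - 1) * (x + 1) = 0 := by linarith
    rcases mul_eq_zero.1 this with h | h
    · have : x = 1 := by linarith
      subst this
      have : b * R = 0 := by linarith
      have := (mul_eq_zero.1 this).resolve_left hb.ne'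
      rw [this] at k2; norm_num at k2
    · have : x = -1 := by linarith
      subst this
      have : R = 0 := by linarith
      subst this
      have : g ^ 2 = 0 := by linarith
      exact hg0 (by simpa using this)
  -- `x (x-1) g^2 = b (x+1)`, so `(g x (x-1))^2 = b (x^3-x)`
  have k3 : x * (x - 1) * g ^ 2 = b * (x + 1) := by linear_combination -x * k1 + b * k2
  obtain ⟨Y, hY⟩ : ∃ Y, Y = g * x * (x - 1) / b := ⟨_, rfl⟩
  have hYb : Y * b = g * x * (x - 1) := by rw [hY]; field_simp
  have hcurve : b * Y ^ 2 = x * (x ^ 2 - 1) := by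
    have : b * (b * Y ^ 2) = b * (x * (x ^ 2 - 1)) := by
      have : b * (b * Y ^ 2) = (Y * b) ^ 2 := by ring
      rw [this, hYb]
      linear_combination x * (x - 1) * k3
    exact mul_left_cancel₀ hb.ne' this
  have hY0 : Y ≠ 0 := by
    rintro rfl
    have : x * (x ^ 2 - 1) = 0 := by linarith
    exact (mul_ne_zero hx0 hxm) this
  have hpos : 0 < x * (x ^ 2 - 1) := by rw [← hcurve]; positivity
  refine ⟨|(x ^ 2 - 1) / Y|, |2 * x / Y|, |(x ^ 2 + 1) / Y|, ?_, ?_, ?_, ?_, ?_⟩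
  · exact abs_pos.2 (div_ne_zero hxm hY0)
  · exact abs_pos.2 (by positivity)
  · exact abs_pos.2 (by positivity)
  · simp only [sq_abs]; field_simp; ring
  · rw [← abs_mul]
    have : (x ^ 2 - 1) / Y * (2 * x / Y) = 2 * b := by
      field_simp; linarith
    rw [this, abs_of_pos (by positivity)]; ring


/-- Let `B` be a positive odd square-free integer (so `2B` is square-free) and `C` a
square-free integer with `C ∉ {0, 1, 2, 2B}` such that `L = ℚ(√B, √(2B), √C)` is a
triquadratic number field. Then `min deg_L(√B + √(2B)) = 2` iff `B` is a congruent
number. -/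
theorem stmt_8 (B C : ℤ) (hBpos : 0 < B) (hBsf : Squarefree B) (hBodd : Odd B)
    (hCsf : Squarefree C) (hC0 : C ≠ 0) (hC1 : C ≠ 1) (hC2 : C ≠ 2) (hC2B : C ≠ 2 * B)
    (hCB : C ≠ B)
    (L : Type*) [Field L] [Algebra ℚ L] (u v w : L)
    (hu : u ^ 2 = algebraMap ℚ L (B : ℚ))
    (hv : v ^ 2 = algebraMap ℚ L ((2 * B : ℤ) : ℚ))
    (hw : w ^ 2 = algebraMap ℚ L (C : ℚ))
    (hgen : IntermediateField.adjoin ℚ {u, v, w} = ⊤)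
    (hdim : Module.finrank ℚ L = 8) :
    minDegree L (u + v) = 2 ↔ IsCongruentNumber B := by
  have hfd : FiniteDimensional ℚ L := FiniteDimensional.of_finrank_pos (by omega)
  have : CharZero L := algebraRat.charZero L
  have hBq : (0 : ℚ) < B := by exact_mod_cast hBpos
  have hCq : (C : ℚ) ≠ 0 := by exact_mod_cast hC0
  have hu0 : u ≠ 0 := by
    rintro rfl
    have : algebraMap ℚ L (B : ℚ) = 0 := by rw [← hu]; simp
    rw [map_eq_zero] at this
    exact hBq.ne' this
  obtain ⟨e, he⟩ : ∃ e, e = v / u := ⟨_, rfl⟩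
  have hveu : v = e * u := by rw [he]; field_simp
  subst hveu
  have he2 : e ^ 2 = 2 := by
    have : e ^ 2 * u ^ 2 = 2 * u ^ 2 := by
      rw [← mul_pow, hv, hu]; push_cast; simp
    exact mul_right_cancel₀ (pow_ne_zero 2 hu0) this
  clear he
  obtain ⟨K, heK, huK, hform, hall, hind, hind4⟩ :=
    structure_lemma (B : ℚ) (C : ℚ) e u w he2 hu hw hgen hdim
  have hw0 : w ≠ 0 := by
    rintro rfl
    have := (hind 0 K.zero_mem 1 K.one_mem (by simp)).2
    exact one_ne_zero this
  have hKtop : K ≠ ⊤ := by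
    intro h
    have hwK : w ∈ K := by rw [h]; trivial
    have := (hind w hwK (-1) (K.neg_mem K.one_mem) (by ring)).2
    exact one_ne_zero (neg_eq_zero.1 this)
  have hprim : ∀ α : L, IntermediateField.adjoin ℚ {α} = ⊤ → α ∉ K := by
    intro α hα hK
    exact hKtop (subalg_eq_top K {α} (by simpa using hK) hα)
  have huvK : u + e * u ∈ K := K.add_mem huK (K.mul_mem heK huK)
  -- no polynomial of degree at most one works
  have hlow : ∀ α : L, IntermediateField.adjoin ℚ {α} = ⊤ → ∀ a b : ℚ,
      algebraMap ℚ L a * α + algebraMap ℚ L b = u + e * u → False := by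
    intro α hα a b h
    by_cases ha : a = 0
    · subst ha
      have := hind4 (-b) 0 1 1 (by rw [map_neg, map_zero, map_one]; rw [map_zero] at h; linear_combination -h)
      exact one_ne_zero this.2.2.1
    · apply hprim α hα
      have ha' : algebraMap ℚ L a ≠ 0 := by simpa using ha
      have : α = algebraMap ℚ L a⁻¹ * (u + e * u - algebraMap ℚ L b) := by
        rw [← h, map_inv₀]; field_simp; ring
      rw [this]
      exact K.mul_mem (K.algebraMap_mem _) (K.sub_mem huvK (K.algebraMap_mem _))
  have hmin : minDegree L (u + e * u) = 2 ↔ ∃ α : L, IntermediateField.adjoin ℚ {α} = ⊤ ∧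
      ∃ a b c : ℚ, a ≠ 0 ∧ algebraMap ℚ L a * α ^ 2 + algebraMap ℚ L b * α + algebraMap ℚ L c
        = u + e * u := by
    unfold minDegree
    constructor
    · intro h
      have hne : {d : ℕ | ∃ α : L, IntermediateField.adjoin ℚ {α} = ⊤ ∧
        ∃ f : Polynomial ℚ, f.natDegree = d ∧ Polynomial.aeval α f = u + e * u}.Nonempty := by
        by_contra hne
        rw [Set.not_nonempty_iff_eq_empty] at hne
        rw [hne] at h
        simp at h
      have hmem := Nat.sInf_mem hne
      rw [h] at hmem
      obtain ⟨α, hα, f, hf, hfα⟩ := hmem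
      refine ⟨α, hα, f.coeff 2, f.coeff 1, f.coeff 0, ?_, ?_⟩
      · rw [← hf]
        intro h0
        have : f = 0 := by simpa using h0
        rw [this] at hf; simp at hf
      · rw [← hfα, Polynomial.aeval_eq_sum_range, hf]
        simp [Finset.sum_range_succ, Algebra.smul_def]
        ring
    · rintro ⟨α, hα, a, b, c, ha, h⟩
      apply le_antisymm
      · apply Nat.sInf_le
        refine ⟨α, hα, Polynomial.C a * Polynomial.X ^ 2 + Polynomial.C b * Polynomial.X
          + Polynomial.C c, Polynomial.natDegree_quadratic ha, ?_⟩
        simpa using h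
      · apply le_csInf
        · exact ⟨2, α, hα, Polynomial.C a * Polynomial.X ^ 2 + Polynomial.C b * Polynomial.X
            + Polynomial.C c, Polynomial.natDegree_quadratic ha, by simpa using h⟩
        · rintro d ⟨α, hα, f, hf, hfα⟩
          by_contra hd
          have hd1 : f.natDegree ≤ 1 := by omega
          apply hlow α hα (f.coeff 1) (f.coeff 0)
          rw [← hfα, Polynomial.aeval_eq_sum_range' (n := 2) (by omega)]
          simp [Finset.sum_range_succ, Algebra.smul_def]
          ring
  rw [hmin]
  constructor
  · rintro ⟨α, hα, a, b, c, ha, h⟩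
    have ha' : algebraMap ℚ L a ≠ 0 := by simpa using ha
    obtain ⟨s, hs⟩ : ∃ s : ℚ, s = b / (2 * a) := ⟨_, rfl⟩
    have hb : b = 2 * a * s := by rw [hs]; field_simp
    obtain ⟨X, hX, Y, hY, hXY⟩ := hall (α + algebraMap ℚ L s)
    have hsq : algebraMap ℚ L a * (α + algebraMap ℚ L s) ^ 2 =
        u + e * u + algebraMap ℚ L (a * s ^ 2 - c) := by
      rw [← h, hb]; simp only [map_mul, map_sub, map_pow, map_ofNat]; ring
    rw [hXY] at hsq
    have hAK := K.algebraMap_mem a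
    have hz := hind (algebraMap ℚ L a * (X ^ 2 + Y ^ 2 * algebraMap ℚ L C)
        - (u + e * u + algebraMap ℚ L (a * s ^ 2 - c)))
      (K.sub_mem (K.mul_mem hAK (K.add_mem (K.pow_mem hX 2)
        (K.mul_mem (K.pow_mem hY 2) (K.algebraMap_mem _)))) (K.add_mem huvK (K.algebraMap_mem _)))
      (algebraMap ℚ L a * (2 * (X * Y)))
      (K.mul_mem hAK (K.mul_mem (by exact_mod_cast K.natCast_mem 2) (K.mul_mem hX hY)))
      (by rw [← hw]; linear_combination hsq)
    obtain ⟨hz1, hz2⟩ := hz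
    have hXY0 : X = 0 ∨ Y = 0 := by simpa [ha] using hz2
    have hY0 : Y ≠ 0 := by
      rintro rfl
      apply hprim α hα
      have : α = X - algebraMap ℚ L s := by linear_combination hXY
      rw [this]
      exact K.sub_mem hX (K.algebraMap_mem _)
    have hX0 : X = 0 := hXY0.resolve_right hY0
    subst hX0
    obtain ⟨p, q, r, t, hk⟩ := hform Y hY
    obtain ⟨g, hg⟩ : ∃ g : ℚ, g = a * C := ⟨_, rfl⟩
    have hmain := hind4 (g * (p ^ 2 + 2 * q ^ 2 + B * r ^ 2 + 2 * B * t ^ 2) - (a * s ^ 2 - c))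
      (g * (2 * (p * q + B * (r * t)))) (g * (2 * (p * r + 2 * (q * t))) - 1)
      (g * (2 * (p * t + q * r)) - 1) (by
        rw [hk] at hz1
        rw [hg]
        simp only [map_mul, map_sub, map_add, map_pow, map_ofNat, map_one] at hz1 ⊢
        rw [← hz1]
        rw [← hu]
        linear_combination -(algebraMap ℚ L a * algebraMap ℚ L C * (2 * algebraMap ℚ L q *
          algebraMap ℚ L t * u + algebraMap ℚ L q ^ 2 + u ^ 2 * algebraMap ℚ L t ^ 2)) * he2)
    obtain ⟨-, m1, m2, m3⟩ := hmain
    have hg0 : g ≠ 0 := by rw [hg]; exact mul_ne_zero ha hCq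
    refine congr_backward B hBpos p q r t ?_ ?_ ?_
    · simpa [hg0] using m1
    · have : g * 2 * (p * r + 2 * (q * t)) = g * 2 * (p * t + q * r) := by linarith
      exact mul_left_cancel₀ (mul_ne_zero hg0 two_ne_zero) this
    · intro h0
      rw [h0] at m3
      norm_num at m3
  · intro hcong
    obtain ⟨p, q, r, t, h1, h2, h3⟩ := congr_forward B hcong
    obtain ⟨d, hd⟩ : ∃ d, d = p * t + q * r := ⟨_, rfl⟩
    obtain ⟨s, hs⟩ : ∃ s : ℚ, s = p ^ 2 + 2 * q ^ 2 + B * r ^ 2 + 2 * B * t ^ 2 := ⟨_, rfl⟩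
    obtain ⟨k, hk⟩ : ∃ k, k = algebraMap ℚ L p + algebraMap ℚ L q * e
        + (algebraMap ℚ L r + algebraMap ℚ L t * e) * u := ⟨_, rfl⟩
    have hd0 : d ≠ 0 := by rw [hd]; exact h3
    have hk2 : k ^ 2 = algebraMap ℚ L s + algebraMap ℚ L (2 * d) * (u + e * u) := by
      have g1 := congrArg (algebraMap ℚ L) h1
      have g2 := congrArg (algebraMap ℚ L) h2
      rw [hk, hd, hs]
      simp only [map_mul, map_sub, map_add, map_pow, map_ofNat, map_zero] at g1 g2 ⊢
      rw [← hu] at g1 ⊢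
      linear_combination (2 * algebraMap ℚ L q * algebraMap ℚ L t * u + algebraMap ℚ L q ^ 2
        + u ^ 2 * algebraMap ℚ L t ^ 2) * he2 + 2 * e * g1 + 2 * u * g2
    have hk0 : k ≠ 0 := by
      rintro rfl
      have := hind4 s 0 (2 * d) (2 * d) (by rw [map_zero]; linear_combination -hk2)
      exact hd0 (by simpa using this.2.2.1)
    have hβ : (k * w) ^ 2 = algebraMap ℚ L (C * s) + algebraMap ℚ L (C * (2 * d)) * (u + e * u) := by
      rw [mul_pow, hw, hk2]; simp only [map_mul]; ring
    have hCd : C * (2 * d) ≠ 0 := mul_ne_zero hCq (mul_ne_zero two_ne_zero hd0)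
    have hCd' : algebraMap ℚ L (C * (2 * d)) ≠ 0 := by
      intro h; exact hCd ((map_eq_zero _).1 h)
    refine ⟨k * w, ?_, (C * (2 * d))⁻¹, 0, - (C * s) * (C * (2 * d))⁻¹, inv_ne_zero hCd, ?_⟩
    · set M := IntermediateField.adjoin ℚ {k * w} with hM
      have hkw : k * w ∈ M := IntermediateField.mem_adjoin_simple_self ℚ _
      have huv : u + e * u ∈ M := by
        have : u + e * u = ((k * w) ^ 2 - algebraMap ℚ L (C * s)) / algebraMap ℚ L (C * (2 * d)) := by
          rw [hβ, eq_div_iff hCd']; ring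
        rw [this]
        exact M.div_mem (M.sub_mem (pow_mem hkw 2) (M.algebraMap_mem _)) (M.algebraMap_mem _)
      have hBL : algebraMap ℚ L B ≠ 0 := by
        intro h; exact hBq.ne' ((map_eq_zero _).1 h)
      have heM : e ∈ M := by
        have : e = ((u + e * u) ^ 2 / algebraMap ℚ L B - algebraMap ℚ L 3) / algebraMap ℚ L 2 := by
          have : (u + e * u) ^ 2 = algebraMap ℚ L B * (3 + 2 * e) := by
            rw [← hu]; linear_combination u ^ 2 * he2
          rw [this, mul_div_cancel_left₀ _ hBL]
          simp
        rw [this]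
        exact M.div_mem (M.sub_mem (M.div_mem (pow_mem huv 2) (M.algebraMap_mem _))
          (M.algebraMap_mem _)) (M.algebraMap_mem _)
      have he1 : 1 + e ≠ 0 := by
        intro h
        have : e = -1 := by linear_combination h
        rw [this] at he2
        norm_num at he2
      have huM : u ∈ M := by
        have : u = (u + e * u) / (1 + e) := by field_simp
        rw [this]
        exact M.div_mem huv (M.add_mem M.one_mem heM)
      have hkM : k ∈ M := by
        rw [hk]
        exact M.add_mem (M.add_mem (M.algebraMap_mem _) (M.mul_mem (M.algebraMap_mem _) heM))
          (M.mul_mem (M.add_mem (M.algebraMap_mem _) (M.mul_mem (M.algebraMap_mem _) heM)) huM)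
      have hwM : w ∈ M := by
        have : w = (k * w) / k := by field_simp
        rw [this]
        exact M.div_mem hkw hkM
      rw [eq_top_iff, ← hgen, IntermediateField.adjoin_le_iff]
      rintro x (rfl | rfl | rfl)
      · exact huM
      · exact M.mul_mem heM huM
      · exact hwM
    · rw [hβ]
      rw [map_mul _ (-(C * s : ℚ)), map_neg, map_inv₀, map_zero]
      generalize algebraMap ℚ L (C * (2 * d)) = D at *
      linear_combination (u + e * u) * inv_mul_cancel₀ hCd'
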